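/- Consider elements a, b, c, d, e, f, g, h, i, j, k, l, m, n, o, p, q, r of ℤ/2ℤ satisfying the eighteen equations: b+c+d = e+f+g; a+b+d = h+i+j; a+c+d = e+m+n; a+b+c = p+q+j; a+f+g = b+m+n; a+e+f = h+k+l; a+e+g = p+r+l; i+c+j = k+g+l; h+c+j = k+n+o; h+i+c = p+q+d; h+g+l = i+n+o; h+k+g = p+r+f; b+e+n = q+r+o; b+e+m = i+k+o; i+k+n = q+r+m; q+d+j = r+f+l; p+d+j = r+m+o; p+f+l = q+m+o. Group the variables into nine rows: (a,b,c,d), (a,e,f,g), (h,i,c,j), (h,k,g,l), (b,e,m,n), (i,k,n,o), (p,q,d,j), (p,r,f,l), (q,r,m,o). Then there is no solution in which, for some row, one designated variable of that row equals 1 and the other three variables of that row equal 0. (This yields a cohomological witness for the Kochen–Specker theorem via the 18-vector configuration of Cabello et al. in ℝ⁴.) -/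

import Mathlib

/-- `oneHotRow w x y z` says that one designated variable of the row `(w, x, y, z)` equals `1`
and the other three equal `0`. -/
def oneHotRow (w x y z : ZMod 2) : Prop :=
  (w = 1 ∧ x = 0 ∧ y = 0 ∧ z = 0) ∨ (x = 1 ∧ w = 0 ∧ y = 0 ∧ z = 0) ∨
  (y = 1 ∧ w = 0 ∧ x = 0 ∧ z = 0) ∨ (z = 1 ∧ w = 0 ∧ x = 0 ∧ y = 0)

theorem oneHotRow.sum_eq_one {w x y z : ZMod 2} (h : oneHotRow w x y z) :
    w + x + y + z = 1 := by
  rcases h with ⟨rfl, rfl, rfl, rfl⟩ | ⟨rfl, rfl, rfl, rfl⟩ | ⟨rfl, rfl, rfl, rfl⟩ |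
    ⟨rfl, rfl, rfl, rfl⟩ <;> rfl

theorem not_oneHotRow_of_sum_eq_zero {w x y z : ZMod 2} (h : w + x + y + z = 0) :
    ¬oneHotRow w x y z :=
  fun hw => zero_ne_one (h.symm.trans hw.sum_eq_one)

/-- If elements `a, …, r` of `ℤ/2ℤ` satisfy the eighteen compatibility equations of the
18-vector Kochen–Specker configuration of Cabello et al. in `ℝ⁴`, then no row (context)
`(a,b,c,d)`, `(a,e,f,g)`, `(h,i,c,j)`, `(h,k,g,l)`, `(b,e,m,n)`, `(i,k,n,o)`, `(p,q,d,j)`,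
`(p,r,f,l)`, `(q,r,m,o)` has one designated variable equal to `1` and the other three equal
to `0`. (This yields a cohomological witness for the Kochen–Specker theorem.) -/
theorem cabello18_obstruction_nonvanishing
    (a b c d e f g h i j k l m n o p q r : ZMod 2)
    (h1 : b + c + d = e + f + g) (h2 : a + b + d = h + i + j)
    (h3 : a + c + d = e + m + n) (h4 : a + b + c = p + q + j)
    (h5 : a + f + g = b + m + n) (h6 : a + e + f = h + k + l)
    (h7 : a + e + g = p + r + l) (h8 : i + c + j = k + g + l)
    (h9 : h + c + j = k + n + o) (h10 : h + i + c = p + q + d)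
    (h11 : h + g + l = i + n + o) (h12 : h + k + g = p + r + f)
    (h13 : b + e + n = q + r + o) (h14 : b + e + m = i + k + o)
    (h15 : i + k + n = q + r + m) (h16 : q + d + j = r + f + l)
    (h17 : p + d + j = r + m + o) (h18 : p + f + l = q + m + o) :
    ¬(oneHotRow a b c d ∨ oneHotRow a e f g ∨ oneHotRow h i c j ∨
      oneHotRow h k g l ∨ oneHotRow b e m n ∨ oneHotRow i k n o ∨
      oneHotRow p q d j ∨ oneHotRow p r f l ∨ oneHotRow q r m o) := by
  -- Adding the shared variable to both sides, each equation equates the sums of two rows; all nine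
  -- row sums agree, and they add up to `0` because every variable lies in exactly two rows.
  have two : (2 : ZMod 2) = 0 := rfl
  have abcd : a + b + c + d = 0 := by
    linear_combination 3 * h1 + h2 + 3 * h3 + h4 + h6 + h7 + h13 + h14 +
      (a + b + c + d + e + f + g + h + i + j + k + l + m + n + o + p + q + r
        - 4 * (a + b + c + d)) * two
  have aefg : a + e + f + g = 0 := by linear_combination abcd - h1
  have hicj : h + i + c + j = 0 := by linear_combination abcd - h2
  have hkgl : h + k + g + l = 0 := by linear_combination aefg - h6
  have bemn : b + e + m + n = 0 := by linear_combination abcd - h3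
  have ikno : i + k + n + o = 0 := by linear_combination bemn - h14
  have pqdj : p + q + d + j = 0 := by linear_combination abcd - h4
  have prfl : p + r + f + l = 0 := by linear_combination aefg - h7
  have qrmo : q + r + m + o = 0 := by linear_combination bemn - h13
  simp only [not_or]
  exact ⟨not_oneHotRow_of_sum_eq_zero abcd, not_oneHotRow_of_sum_eq_zero aefg,
    not_oneHotRow_of_sum_eq_zero hicj, not_oneHotRow_of_sum_eq_zero hkgl,
    not_oneHotRow_of_sum_eq_zero bemn, not_oneHotRow_of_sum_eq_zero ikno,
    not_oneHotRow_of_sum_eq_zero pqdj, not_oneHotRow_of_sum_eq_zero prfl,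
    not_oneHotRow_of_sum_eq_zero qrmo⟩
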